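/- arXiv:2503.21604 — 3 statements merged into one kernel-verified Lean document; each statement's English description precedes it below -/
import Mathlib

section
/- For every compact set K ⊂ ℝ × (0, ∞) there exists a constant C_K > 0 such that for all x, y ∈ K with x ≠ y one has |S(x, y)| ≤ C_K, where S(x, y) := G(x, y) − (1/(2π))·√(x_r·y_r)·ln|x − y|. -/
/-- The profile function of the Green kernel of the axisymmetric operator
`div((1/r)∇·)` on the half-plane. -/
noncomputable def F (s : ℝ) : ℝ :=
  ∫ θ in (0:ℝ)..(Real.pi/2), Real.cos (2*θ) / Real.sqrt (Real.sin θ ^ 2 + s/4)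

/-- The Green kernel `G(x, y) = −(1/(2π))·√(x_r·y_r)·F(|x − y|²/(x_r·y_r))` on the
half-plane, where a point `x ∈ ℝ²` is written `x = (x 0, x 1) = (x_z, x_r)`. -/
noncomputable def Gker (x y : EuclideanSpace ℝ (Fin 2)) : ℝ :=
  -(1/(2*Real.pi)) * Real.sqrt (x 1 * y 1) * F (‖x - y‖^2 / (x 1 * y 1))

/-- The regular part `S(x, y) = G(x, y) − (1/(2π))·√(x_r·y_r)·ln|x − y|`. -/
noncomputable def Sker (x y : EuclideanSpace ℝ (Fin 2)) : ℝ :=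
  Gker x y - (1/(2*Real.pi)) * Real.sqrt (x 1 * y 1) * Real.log ‖x - y‖

open Real intervalIntegral in
theorem integral_cos_div_sqrt_sin_sq_add {b : ℝ} (hb : 0 < b) :
    ∫ θ in (0:ℝ)..(π / 2), cos θ / √(sin θ ^ 2 + b) = log (1 + √(1 + b)) - log b / 2 := by
  have hpos : ∀ θ : ℝ, 0 < sin θ ^ 2 + b := fun θ => by positivity
  have hsum : ∀ θ : ℝ, 0 < sin θ + √(sin θ ^ 2 + b) := fun θ => by
    have : |sin θ| < √(sin θ ^ 2 + b) := by
      rw [← sqrt_sq_eq_abs]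
      exact sqrt_lt_sqrt (sq_nonneg _) (by linarith)
    linarith [neg_abs_le (sin θ)]
  rw [integral_eq_sub_of_hasDerivAt (f := fun θ => log (sin θ + √(sin θ ^ 2 + b)))]
  · simp [log_sqrt hb.le]
  · intro θ _
    have h := ((hasDerivAt_sin θ).add
      ((((hasDerivAt_sin θ).pow 2).add_const b).sqrt (hpos θ).ne')).log (hsum θ).ne'
    refine h.congr_deriv ?_
    have h1 := (sqrt_pos.2 (hpos θ)).ne'
    have h2 := (hsum θ).ne'
    simp only [Pi.add_apply, Pi.pow_apply] at *
    field_simp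
    push_cast
    ring
  · refine Continuous.intervalIntegrable ?_ _ _
    exact continuous_cos.div (by fun_prop) fun θ => (sqrt_pos.2 (hpos θ)).ne'

open Real intervalIntegral in
theorem abs_F_sub_integral_le {s : ℝ} (hs : 0 < s) :
    |F s - ∫ θ in (0:ℝ)..(π / 2), cos θ / √(sin θ ^ 2 + s / 4)| ≤ 3 * (π / 2) := by
  have hpos : ∀ θ : ℝ, 0 < √(sin θ ^ 2 + s / 4) := fun θ => by positivity
  have hint : ∀ f : ℝ → ℝ, Continuous f →
      IntervalIntegrable (fun θ => f θ / √(sin θ ^ 2 + s / 4)) MeasureTheory.volume 0 (π / 2) :=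
    fun f hf => (hf.div (by fun_prop) fun θ => (hpos θ).ne').intervalIntegrable _ _
  rw [F, ← integral_sub (hint _ (by fun_prop)) (hint _ (by fun_prop))]
  rw [← norm_eq_abs]
  refine (norm_integral_le_of_norm_le_const (E := ℝ) (C := 3) fun θ hθ => ?_).trans_eq ?_
  · rw [Set.uIoc_of_le (by positivity)] at hθ
    have hsin : 0 ≤ sin θ := sin_nonneg_of_nonneg_of_le_pi hθ.1.le (by linarith [hθ.2, pi_pos])
    have hcos : 0 ≤ cos θ := cos_nonneg_of_mem_Icc ⟨by linarith [hθ.1, pi_pos], hθ.2⟩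
    have hle : sin θ ≤ √(sin θ ^ 2 + s / 4) := le_sqrt_of_sq_le (by linarith)
    have hc1 := cos_le_one θ
    have hs1 := sin_le_one θ
    have hsq := sin_sq_add_cos_sq θ
    have hcs : 1 - cos θ ≤ sin θ := by nlinarith
    rw [← sub_div, norm_div, norm_of_nonneg (hpos θ).le, div_le_iff₀ (hpos θ), cos_two_mul,
      norm_eq_abs, abs_le]
    constructor <;> nlinarith
  · rw [sub_zero, abs_of_pos (by positivity)]

open Real in
theorem abs_F_add_half_log_le {s : ℝ} (hs : 0 < s) :
    |F s + log s / 2| ≤ 3 * (π / 2) + 2 + s / 4 := by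
  have h := abs_F_sub_integral_le hs
  rw [integral_cos_div_sqrt_sin_sq_add (by positivity), log_div hs.ne' (by norm_num),
    show (4:ℝ) = 2 ^ 2 by norm_num, log_pow] at h
  have hsqrt : √(1 + s / 2 ^ 2) ≤ 1 + s / 4 := by
    rw [sqrt_le_left (by positivity)]
    nlinarith [sq_nonneg s]
  have hlog : log (1 + √(1 + s / 2 ^ 2)) ≤ √(1 + s / 2 ^ 2) := by
    linarith [log_le_sub_one_of_pos (x := 1 + √(1 + s / 2 ^ 2)) (by positivity)]
  have hlog0 : 0 ≤ log (1 + √(1 + s / 2 ^ 2)) :=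
    log_nonneg (by linarith [sqrt_nonneg (1 + s / 2 ^ 2)])
  have h2 : log 2 ≤ 1 := by linarith [log_le_sub_one_of_pos (x := 2) (by norm_num)]
  have h20 : 0 ≤ log 2 := log_nonneg (by norm_num)
  push_cast at h
  rw [abs_le] at h ⊢
  constructor <;> linarith [h.1, h.2]

open Real in
theorem abs_Sker_le {x y : EuclideanSpace ℝ (Fin 2)} (hx : 0 < x 1) (hy : 0 < y 1)
    (hxy : x ≠ y) :
    |Sker x y| ≤ 1 / (2 * π) * √(x 1 * y 1) *
      (3 * (π / 2) + 2 + ‖x - y‖ ^ 2 / (x 1 * y 1) / 4 + |log (x 1 * y 1)| / 2) := by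
  have hp : 0 < x 1 * y 1 := mul_pos hx hy
  have hn : 0 < ‖x - y‖ := norm_pos_iff.2 (sub_ne_zero.2 hxy)
  have hs : 0 < ‖x - y‖ ^ 2 / (x 1 * y 1) := by positivity
  have hF := abs_F_add_half_log_le hs
  have hlog : log (‖x - y‖ ^ 2 / (x 1 * y 1)) = 2 * log ‖x - y‖ - log (x 1 * y 1) := by
    rw [log_div (by positivity) hp.ne', log_pow]
    norm_num
  have hS : Sker x y = -(1 / (2 * π) * √(x 1 * y 1) * (F (‖x - y‖ ^ 2 / (x 1 * y 1)) +
      log (‖x - y‖ ^ 2 / (x 1 * y 1)) / 2 + log (x 1 * y 1) / 2)) := by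
    rw [Sker, Gker, hlog]
    ring
  rw [hS, abs_neg, abs_mul, abs_of_nonneg (by positivity : 0 ≤ 1 / (2 * π) * √(x 1 * y 1))]
  gcongr
  refine (abs_add_le _ _).trans (add_le_add hF ?_)
  rw [abs_div, abs_two]

/-- For every compact set `K ⊂ ℝ × (0, ∞)` there exists `C_K > 0` such that
`|S(x, y)| ≤ C_K` for all `x, y ∈ K` with `x ≠ y`. -/
theorem stmt_3 (K : Set (EuclideanSpace ℝ (Fin 2))) (hK : IsCompact K)
    (hKpos : ∀ x ∈ K, 0 < x 1) :
    ∃ C > (0:ℝ), ∀ x ∈ K, ∀ y ∈ K, x ≠ y → |Sker x y| ≤ C := by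
  have hne : ∀ q ∈ K ×ˢ K, q.1 1 * q.2 1 ≠ 0 := fun q hq =>
    (mul_pos (hKpos _ hq.1) (hKpos _ hq.2)).ne'
  have hprod : ContinuousOn
      (fun q : EuclideanSpace ℝ (Fin 2) × EuclideanSpace ℝ (Fin 2) => q.1 1 * q.2 1)
      (K ×ˢ K) := by fun_prop
  obtain ⟨C, hC⟩ := (hK.prod hK).exists_bound_of_continuousOn
    (f := fun q => 1 / (2 * Real.pi) * Real.sqrt (q.1 1 * q.2 1) *
      (3 * (Real.pi / 2) + 2 + ‖q.1 - q.2‖ ^ 2 / (q.1 1 * q.2 1) / 4 +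
        |Real.log (q.1 1 * q.2 1)| / 2))
    ((continuousOn_const.mul hprod.sqrt).mul
      ((continuousOn_const.add
        ((ContinuousOn.div (by fun_prop) hprod hne).div_const 4)).add
        ((hprod.log hne).abs.div_const 2)))
  refine ⟨max C 1, by positivity, fun x hx y hy hxy => ?_⟩
  exact (abs_Sker_le (hKpos x hx) (hKpos y hy) hxy).trans
    ((le_abs_self _).trans ((hC (x, y) ⟨hx, hy⟩).trans (le_max_left _ _)))
end

section
/- For every compact set K ⊂ ℝ × (0, ∞) there exists a constant C_K > 0 such that for all x, y ∈ K with x ≠ y, the map x ↦ S(x, y) is differentiable at x and its gradient satisfies |∇ₓS(x, y)| ≤ C_K, where S(x, y) := G(x, y) − (1/(2π))·√(x_r·y_r)·ln|x − y|. -/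
/-- The regular part of the profile function, in the variable `a = s / 4`. -/
noncomputable def regInt (a : ℝ) : ℝ :=
  ∫ θ in (0:ℝ)..(Real.pi/2),
    (Real.cos (2*θ) - Real.cos θ) / Real.sqrt (Real.sin θ ^ 2 + a)

theorem abs_cos_two_mul_sub_cos_le {θ : ℝ} (hθ : θ ∈ Set.Icc 0 (Real.pi/2)) :
    |Real.cos (2*θ) - Real.cos θ| ≤ 2 * Real.sin θ ^ 2 := by
  have hc : 0 ≤ Real.cos θ :=
    Real.cos_nonneg_of_mem_Icc ⟨by linarith [hθ.1, Real.pi_pos], hθ.2⟩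
  have hc1 := Real.cos_le_one θ
  have := Real.sin_sq_add_cos_sq θ
  rw [Real.cos_two_mul, abs_le]
  constructor <;> nlinarith

theorem abs_regInt_le {a : ℝ} (ha : 0 < a) : |regInt a| ≤ Real.pi := by
  have h : ∀ θ ∈ Set.uIoc (0:ℝ) (Real.pi/2),
      ‖(Real.cos (2*θ) - Real.cos θ) / Real.sqrt (Real.sin θ ^ 2 + a)‖ ≤ 2 := by
    intro θ hθ
    rw [Set.uIoc_of_le (by positivity)] at hθ
    have h1 := abs_cos_two_mul_sub_cos_le (Set.Ioc_subset_Icc_self hθ)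
    have hs := Real.sin_sq_le_one θ
    have h2 : Real.sin θ ^ 2 ≤ Real.sqrt (Real.sin θ ^ 2 + a) :=
      Real.le_sqrt_of_sq_le (by nlinarith [sq_nonneg (Real.sin θ)])
    rw [Real.norm_eq_abs, abs_div, abs_of_nonneg (Real.sqrt_nonneg _),
      div_le_iff₀ (by positivity)]
    linarith
  have := intervalIntegral.norm_integral_le_of_norm_le_const h
  rw [Real.norm_eq_abs, sub_zero, abs_of_nonneg (by positivity : 0 ≤ Real.pi/2)] at this
  unfold regInt
  linarith

theorem norm_deriv_integrand_le {θ x b : ℝ} (hθ : θ ∈ Set.Icc 0 (Real.pi/2)) (hb : 0 < b)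
    (hx : b ≤ x) :
    ‖-(Real.cos (2*θ) - Real.cos θ) /
      (2 * ((Real.sin θ ^ 2 + x) * Real.sqrt (Real.sin θ ^ 2 + x)))‖ ≤ 1 / Real.sqrt b := by
  have h1 := abs_cos_two_mul_sub_cos_le hθ
  have hp : 0 < Real.sin θ ^ 2 + x := by nlinarith [sq_nonneg (Real.sin θ)]
  have h2 : Real.sqrt b ≤ Real.sqrt (Real.sin θ ^ 2 + x) :=
    Real.sqrt_le_sqrt (by nlinarith [sq_nonneg (Real.sin θ)])
  have hb' := Real.sqrt_pos.2 hb
  have hp' := Real.sqrt_pos.2 hp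
  rw [Real.norm_eq_abs, abs_div, abs_neg,
    abs_of_pos (by positivity : 0 < 2 * ((Real.sin θ ^ 2 + x) * Real.sqrt (Real.sin θ ^ 2 + x))),
    div_le_div_iff₀ (by positivity) hb', one_mul]
  have : Real.sin θ ^ 2 ≤ Real.sin θ ^ 2 + x := by linarith
  calc _ ≤ 2 * (Real.sin θ ^ 2 + x) * Real.sqrt (Real.sin θ ^ 2 + x) := by gcongr; linarith
    _ = _ := by ring

theorem exists_hasDerivAt_regInt {a : ℝ} (ha : 0 < a) :
    ∃ d, HasDerivAt regInt d a ∧ |d| ≤ Real.pi / 2 / Real.sqrt a := by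
  have hpos : ∀ x ∈ Set.Ioi (a/2), ∀ θ : ℝ, 0 < Real.sin θ ^ 2 + x := fun x hx θ => by
    have : a / 2 < x := hx
    nlinarith [sq_nonneg (Real.sin θ)]
  have hcont : ∀ x ∈ Set.Ioi (a/2), Continuous fun θ : ℝ =>
      (Real.cos (2*θ) - Real.cos θ) / Real.sqrt (Real.sin θ ^ 2 + x) := fun x hx =>
    Continuous.div (by fun_prop) (by fun_prop) fun θ => (Real.sqrt_pos.2 (hpos x hx θ)).ne'
  have hmem : Set.Ioi (a/2) ∈ nhds a := Ioi_mem_nhds (by linarith)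
  have hcont' : Continuous fun θ : ℝ => -(Real.cos (2*θ) - Real.cos θ) /
      (2 * ((Real.sin θ ^ 2 + a) * Real.sqrt (Real.sin θ ^ 2 + a))) :=
    Continuous.div (by fun_prop) (by fun_prop) fun θ => by
      have := hpos a (mem_of_mem_nhds hmem) θ
      positivity
  have key := intervalIntegral.hasDerivAt_integral_of_dominated_loc_of_deriv_le
    (μ := MeasureTheory.volume) (a := 0) (b := Real.pi/2)
    (F := fun x θ => (Real.cos (2*θ) - Real.cos θ) / Real.sqrt (Real.sin θ ^ 2 + x))
    (F' := fun x θ => -(Real.cos (2*θ) - Real.cos θ) /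
      (2 * ((Real.sin θ ^ 2 + x) * Real.sqrt (Real.sin θ ^ 2 + x))))
    (x₀ := a) (s := Set.Ioi (a/2)) (bound := fun _ => 1 / Real.sqrt (a/2)) hmem
    (Filter.eventually_of_mem hmem fun x hx => (hcont x hx).aestronglyMeasurable)
    ((hcont a (mem_of_mem_nhds hmem)).intervalIntegrable _ _)
    hcont'.aestronglyMeasurable
    (Filter.Eventually.of_forall fun θ hθ x hx => by
      rw [Set.uIoc_of_le (by positivity)] at hθ
      exact norm_deriv_integrand_le (Set.Ioc_subset_Icc_self hθ) (by positivity) (le_of_lt hx))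
    intervalIntegrable_const
    (Filter.Eventually.of_forall fun θ _ x hx => by
      have hp := hpos x hx θ
      have h := (hasDerivAt_const x (Real.cos (2*θ) - Real.cos θ)).fun_div
        (((hasDerivAt_id' x).const_add (Real.sin θ ^ 2)).sqrt hp.ne') (Real.sqrt_pos.2 hp).ne'
      refine h.congr_deriv ?_
      rw [Real.sq_sqrt hp.le]
      have := Real.sqrt_pos.2 hp
      field_simp
      ring)
  refine ⟨_, key.2, ?_⟩
  have h := intervalIntegral.norm_integral_le_of_norm_le_const
    (f := fun θ => -(Real.cos (2*θ) - Real.cos θ) /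
      (2 * ((Real.sin θ ^ 2 + a) * Real.sqrt (Real.sin θ ^ 2 + a))))
    (a := 0) (b := Real.pi/2) (C := 1 / Real.sqrt a) fun θ hθ => by
      rw [Set.uIoc_of_le (by positivity)] at hθ
      exact norm_deriv_integrand_le (Set.Ioc_subset_Icc_self hθ) ha le_rfl
  rw [sub_zero, abs_of_nonneg (by positivity : 0 ≤ Real.pi/2), Real.norm_eq_abs] at h
  exact h.trans_eq (by ring)

theorem integral_cos_div_sqrt {a : ℝ} (ha : 0 < a) :
    ∫ θ in (0:ℝ)..(Real.pi/2), Real.cos θ / Real.sqrt (Real.sin θ ^ 2 + a) =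
      Real.log (1 + Real.sqrt (1 + a)) - Real.log a / 2 := by
  have hp : ∀ θ : ℝ, 0 < Real.sin θ ^ 2 + a := fun θ => by positivity
  have hq : ∀ θ : ℝ, 0 < Real.sin θ + Real.sqrt (Real.sin θ ^ 2 + a) := fun θ => by
    have : |Real.sin θ| < Real.sqrt (Real.sin θ ^ 2 + a) := by
      rw [← Real.sqrt_sq_eq_abs]
      exact Real.sqrt_lt_sqrt (sq_nonneg _) (by linarith)
    linarith [neg_abs_le (Real.sin θ)]
  rw [intervalIntegral.integral_eq_sub_of_hasDerivAt
    (f := fun θ => Real.log (Real.sin θ + Real.sqrt (Real.sin θ ^ 2 + a)))]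
  · simp [Real.log_sqrt ha.le]
  · intro θ _
    have h := ((Real.hasDerivAt_sin θ).fun_add
      ((((Real.hasDerivAt_sin θ).fun_pow 2).add_const a).sqrt (hp θ).ne')).log (hq θ).ne'
    refine h.congr_deriv ?_
    have h1 := Real.sqrt_pos.2 (hp θ)
    have h2 := hq θ
    field_simp
    push_cast
    ring
  · exact (Continuous.div (by fun_prop) (by fun_prop) fun θ =>
      (Real.sqrt_pos.2 (hp θ)).ne').intervalIntegrable _ _

/-- The profile function with its logarithmic singularity removed, in the variable `s / 4`. -/
noncomputable def regProfile (a : ℝ) : ℝ := regInt a + Real.log (1 + Real.sqrt (1 + a))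

theorem F_eq_regProfile {s : ℝ} (hs : 0 < s) :
    F s = regProfile (s/4) - Real.log (s/4) / 2 := by
  have hp : ∀ θ : ℝ, Real.sqrt (Real.sin θ ^ 2 + s/4) ≠ 0 := fun θ => by positivity
  rw [regProfile, add_sub_assoc, ← integral_cos_div_sqrt (by positivity : 0 < s/4), regInt,
    ← intervalIntegral.integral_add, F]
  · congr 1; ext θ; ring
  · exact (Continuous.div (by fun_prop) (by fun_prop) hp).intervalIntegrable _ _
  · exact (Continuous.div (by fun_prop) (by fun_prop) hp).intervalIntegrable _ _

theorem abs_regProfile_le {a : ℝ} (ha : 0 < a) :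
    |regProfile a| ≤ Real.pi + Real.sqrt (1 + a) := by
  have h0 : 0 ≤ Real.sqrt (1 + a) := Real.sqrt_nonneg _
  have h1 : 0 ≤ Real.log (1 + Real.sqrt (1 + a)) := Real.log_nonneg (by linarith)
  have h2 := Real.log_le_sub_one_of_pos (by positivity : 0 < 1 + Real.sqrt (1 + a))
  refine (abs_add_le _ _).trans (add_le_add (abs_regInt_le ha) ?_)
  rw [abs_of_nonneg h1]
  linarith

theorem exists_hasDerivAt_regProfile {a : ℝ} (ha : 0 < a) :
    ∃ d, HasDerivAt regProfile d a ∧ |d| ≤ (Real.pi / 2 + 1) / Real.sqrt a := by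
  obtain ⟨d, hd, hle⟩ := exists_hasDerivAt_regInt ha
  have hp : 0 < 1 + a := by positivity
  have h1 := Real.sqrt_pos.2 hp
  have h := (((((hasDerivAt_id a).const_add 1).sqrt hp.ne').const_add 1).log
    (by simp only [id]; positivity))
  refine ⟨_, hd.add h, (abs_add_le _ _).trans ?_⟩
  rw [add_div]
  refine add_le_add hle ?_
  simp only [id]
  have h2 : Real.sqrt a ≤ Real.sqrt (1 + a) := Real.sqrt_le_sqrt (by linarith)
  have h3 := Real.sqrt_pos.2 ha
  rw [abs_of_pos (by positivity), div_div]
  gcongr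
  nlinarith

theorem Sker_eq {x y : EuclideanSpace ℝ (Fin 2)} (hx : 0 < x 1) (hy : 0 < y 1) (hxy : x ≠ y) :
    Sker x y = -(1/(2*Real.pi)) * (Real.sqrt (x 1 * y 1) *
      (regProfile (‖x - y‖^2 / (x 1 * y 1) / 4) + (Real.log 2 + Real.log (x 1 * y 1) / 2))) := by
  have hn : 0 < ‖x - y‖ := norm_pos_iff.2 (sub_ne_zero.2 hxy)
  have hp : 0 < x 1 * y 1 := mul_pos hx hy
  have h4 : Real.log 4 = 2 * Real.log 2 := by
    rw [show (4:ℝ) = 2^2 by norm_num, Real.log_pow]; norm_num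
  rw [Sker, Gker, F_eq_regProfile (by positivity), Real.log_div (by positivity) (by norm_num),
    Real.log_div (by positivity) hp.ne', Real.log_pow, h4]
  push_cast
  ring

/-- An upper bound for `|∇ₓ S(x, y)|` that is continuous in `(x, y)` up to the diagonal. -/
noncomputable def gradBound (x y : EuclideanSpace ℝ (Fin 2)) : ℝ :=
  1/(2*Real.pi) * (Real.sqrt (x 1 * y 1) *
    ((Real.pi/2 + 1) / 2 * (2 / Real.sqrt (x 1 * y 1) +
        ‖x - y‖ * y 1 / (x 1 * y 1 * Real.sqrt (x 1 * y 1))) +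
      (y 1 / (x 1 * y 1)) / 2) +
    (Real.pi + Real.sqrt (1 + ‖x - y‖^2 / (x 1 * y 1) / 4) +
      (Real.log 2 + |Real.log (x 1 * y 1)| / 2)) * (y 1 / (2 * Real.sqrt (x 1 * y 1))))

theorem exists_hasFDerivAt_Sker {x y : EuclideanSpace ℝ (Fin 2)} (hx : 0 < x 1) (hy : 0 < y 1)
    (hxy : x ≠ y) :
    ∃ L : EuclideanSpace ℝ (Fin 2) →L[ℝ] ℝ, HasFDerivAt (fun z => Sker z y) L x ∧ ‖L‖ ≤ gradBound x y := by
  have hn : 0 < ‖x - y‖ := norm_pos_iff.2 (sub_ne_zero.2 hxy)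
  have hp : 0 < x 1 * y 1 := mul_pos hx hy
  have hq : 0 < ‖x - y‖^2 / (x 1 * y 1) / 4 := by positivity
  have hP : HasFDerivAt (fun z : EuclideanSpace ℝ (Fin 2) => z 1 * y 1)
      (y 1 • (EuclideanSpace.proj 1 : EuclideanSpace ℝ (Fin 2) →L[ℝ] ℝ)) x :=
    (EuclideanSpace.proj 1 : EuclideanSpace ℝ (Fin 2) →L[ℝ] ℝ).hasFDerivAt.mul_const (y 1)
  have hPn : ‖y 1 • (EuclideanSpace.proj 1 : EuclideanSpace ℝ (Fin 2) →L[ℝ] ℝ)‖ ≤ y 1 := by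
    rw [norm_smul, Real.norm_of_nonneg hy.le]
    refine mul_le_of_le_one_right hy.le
      (ContinuousLinearMap.opNorm_le_bound (EuclideanSpace.proj 1 : EuclideanSpace ℝ (Fin 2) →L[ℝ] ℝ)
        zero_le_one ?_)
    intro z
    rw [one_mul]
    exact PiLp.norm_apply_le z 1
  generalize y 1 • (EuclideanSpace.proj 1 : EuclideanSpace ℝ (Fin 2) →L[ℝ] ℝ) = P' at hP hPn
  have hN : HasFDerivAt (fun z : EuclideanSpace ℝ (Fin 2) => ‖z - y‖^2)
      (2 • innerSL ℝ (x - y)) x := by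
    simpa using ((hasFDerivAt_id x).sub_const y).norm_sq
  have hNn : ‖2 • innerSL ℝ (x - y)‖ ≤ 2 * ‖x - y‖ := by
    refine norm_nsmul_le.trans ?_
    rw [innerSL_apply_norm, Nat.cast_ofNat]
  generalize 2 • innerSL ℝ (x - y) = N' at hN hNn
  obtain ⟨d, hd, hdle⟩ := exists_hasDerivAt_regProfile hq
  have hinv := (hasDerivAt_inv hp.ne').comp_hasFDerivAt x hP
  have hQ := (hN.mul hinv).mul_const (1/4:ℝ)
  have hT := HasDerivAt.comp_hasFDerivAt x (f := fun z : EuclideanSpace ℝ (Fin 2) =>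
    ‖z - y‖^2 / (z 1 * y 1) / 4) hd (hQ.congr_of_eventuallyEq (Filter.Eventually.of_forall
      fun z => by simp; ring))
  have hL := (((hP.sqrt hp.ne').mul (hT.add (((hP.log hp.ne').mul_const (1/2:ℝ)).const_add
    (Real.log 2)))).const_mul (-(1/(2*Real.pi))))
  refine ⟨_, hL.congr_of_eventuallyEq ?_, ?_⟩
  · have h1 : ∀ᶠ z : EuclideanSpace ℝ (Fin 2) in nhds x, 0 < z 1 :=
      (EuclideanSpace.proj 1 : EuclideanSpace ℝ (Fin 2) →L[ℝ] ℝ).continuous.continuousAt.eventually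
        (lt_mem_nhds hx)
    filter_upwards [h1, isOpen_ne.mem_nhds hxy] with z hz hzy
    rw [Sker_eq hz hy hzy]
    simp [div_eq_mul_inv]
  · simp only [Pi.add_apply, Function.comp_apply]
    have hR := abs_regProfile_le hq
    have hsq := Real.sq_sqrt hp.le
    have hu := Real.sqrt_pos.2 hp
    have hpi := Real.pi_pos
    have hsqrt : Real.sqrt (‖x - y‖^2 / (x 1 * y 1) / 4) =
        ‖x - y‖ / (2 * Real.sqrt (x 1 * y 1)) := by
      rw [← Real.sqrt_sq (by positivity : 0 ≤ ‖x - y‖ / (2 * Real.sqrt (x 1 * y 1))), div_pow,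
        mul_pow, hsq]
      congr 1
      ring
    have hQn : ‖d • (1/4:ℝ) • (‖x - y‖^2 • -((x 1 * y 1)^2)⁻¹ • P' + (x 1 * y 1)⁻¹ • N')‖ ≤
        (Real.pi/2 + 1) / 2 * (2 / Real.sqrt (x 1 * y 1) +
          ‖x - y‖ * y 1 / (x 1 * y 1 * Real.sqrt (x 1 * y 1))) := by
      calc _ ≤ |d| * ((1/4) * (‖x - y‖^2 * (((x 1 * y 1)^2)⁻¹ * ‖P'‖) +
              (x 1 * y 1)⁻¹ * ‖N'‖)) := by
            rw [norm_smul, norm_smul, Real.norm_eq_abs, Real.norm_of_nonneg (by norm_num)]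
            gcongr
            refine (norm_add_le _ _).trans_eq ?_
            rw [norm_smul, norm_smul, norm_smul, norm_neg, Real.norm_of_nonneg (by positivity),
              Real.norm_of_nonneg (by positivity), Real.norm_of_nonneg (by positivity)]
        _ ≤ (Real.pi/2 + 1) / (‖x - y‖ / (2 * Real.sqrt (x 1 * y 1))) *
              ((1/4) * (‖x - y‖^2 * (((x 1 * y 1)^2)⁻¹ * y 1) +
                (x 1 * y 1)⁻¹ * (2 * ‖x - y‖))) := by
            rw [hsqrt] at hdle
            gcongr
        _ = _ := by
            generalize ‖x - y‖ = n at *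
            generalize Real.sqrt (x 1 * y 1) = u at *
            rw [← hsq]
            field_simp
            ring
    have hlog2 : 0 ≤ Real.log 2 := Real.log_nonneg one_le_two
    have hTn : |regProfile (‖x - y‖^2 / (x 1 * y 1) / 4) +
        (Real.log 2 + Real.log (x 1 * y 1) * (1/2))| ≤
        Real.pi + Real.sqrt (1 + ‖x - y‖^2 / (x 1 * y 1) / 4) +
          (Real.log 2 + |Real.log (x 1 * y 1)| / 2) := by
      refine (abs_add_le _ _).trans (add_le_add hR ((abs_add_le _ _).trans_eq ?_))
      rw [abs_of_nonneg hlog2, abs_mul, abs_of_pos (by norm_num : (0:ℝ) < 1/2)]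
      ring
    rw [norm_smul, norm_neg, Real.norm_of_nonneg (by positivity), gradBound]
    gcongr
    refine (norm_add_le _ _).trans (add_le_add ?_ ?_)
    · rw [norm_smul, Real.norm_of_nonneg hu.le]
      gcongr
      refine (norm_add_le _ _).trans (add_le_add hQn ?_)
      rw [norm_smul, norm_smul, Real.norm_of_nonneg (by norm_num),
        Real.norm_of_nonneg (by positivity)]
      calc _ ≤ 1/2 * ((x 1 * y 1)⁻¹ * y 1) := by gcongr
        _ = _ := by ring
    · rw [norm_smul, norm_smul, Real.norm_eq_abs, Real.norm_of_nonneg (by positivity)]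
      refine mul_le_mul hTn ?_ (by positivity) (by positivity)
      rw [one_div, inv_mul_eq_div]
      gcongr

theorem continuousOn_gradBound : ContinuousOn
    (fun p : EuclideanSpace ℝ (Fin 2) × EuclideanSpace ℝ (Fin 2) => gradBound p.1 p.2)
    {p | 0 < p.1 1 ∧ 0 < p.2 1} := by
  have h : ContinuousOn (fun p : EuclideanSpace ℝ (Fin 2) × EuclideanSpace ℝ (Fin 2) =>
      (p.1 1 * p.2 1)⁻¹) {p | 0 < p.1 1 ∧ 0 < p.2 1} :=
    ContinuousOn.inv₀ (by fun_prop) fun p hp => (mul_pos hp.1 hp.2).ne'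
  have hsqrt : ContinuousOn (fun p : EuclideanSpace ℝ (Fin 2) × EuclideanSpace ℝ (Fin 2) =>
      (Real.sqrt (p.1 1 * p.2 1))⁻¹) {p | 0 < p.1 1 ∧ 0 < p.2 1} :=
    ContinuousOn.inv₀ (by fun_prop) fun p hp => (Real.sqrt_pos.2 (mul_pos hp.1 hp.2)).ne'
  have hlog : ContinuousOn (fun p : EuclideanSpace ℝ (Fin 2) × EuclideanSpace ℝ (Fin 2) =>
      Real.log (p.1 1 * p.2 1)) {p | 0 < p.1 1 ∧ 0 < p.2 1} :=
    ContinuousOn.log (by fun_prop) fun p hp => (mul_pos hp.1 hp.2).ne'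
  simp only [gradBound, div_eq_mul_inv, mul_inv _ (Real.sqrt _)]
  fun_prop

/-- For every compact set `K ⊂ ℝ × (0, ∞)` there exists `C_K > 0` such that for all
`x, y ∈ K` with `x ≠ y`, the map `x ↦ S(x, y)` is differentiable at `x` and
`|∇ₓ S(x, y)| ≤ C_K`. -/
theorem stmt_4 (K : Set (EuclideanSpace ℝ (Fin 2))) (hK : IsCompact K)
    (hKpos : ∀ x ∈ K, 0 < x 1) :
    ∃ C > (0:ℝ), ∀ x ∈ K, ∀ y ∈ K, x ≠ y →
      DifferentiableAt ℝ (fun z => Sker z y) x ∧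
      ‖gradient (fun z => Sker z y) x‖ ≤ C := by
  obtain ⟨C, hC⟩ := (hK.prod hK).exists_bound_of_continuousOn (continuousOn_gradBound.mono
    fun p hp => ⟨hKpos _ hp.1, hKpos _ hp.2⟩)
  refine ⟨max C 1, by positivity, fun x hx y hy hxy => ?_⟩
  obtain ⟨L, hL, hle⟩ := exists_hasFDerivAt_Sker (hKpos x hx) (hKpos y hy) hxy
  refine ⟨hL.differentiableAt, ?_⟩
  rw [gradient, LinearIsometryEquiv.norm_map, hL.fderiv]
  exact hle.trans ((le_abs_self _).trans ((hC (x, y) ⟨hx, hy⟩).trans (le_max_left _ _)))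
end

section
/- Let N ≥ 2, γ > 0, r* > 0 and T > 0. Let q = (q₁, …, q_N) : [0, T] → (ℝ²)^N be C¹ with q_i(t) ≠ q_j(t) for all i ≠ j and t ∈ [0, T], satisfying for each i the ODE dq_i/dt = (γ/(2π))·Σ_{j≠i} (q_i − q_j)^⊥/|q_i − q_j|² − (γ/(4π(r*)²))·q_{i,r}·e_z. Then for every t ∈ [0, T], the sum over all ordered pairs (i, j), i ≠ j, with |q_i(t) − q_j(t)| < 1 of |ln|q_i(t) − q_j(t)|| is at most 2√2·N^{3/2}·√(I(t)) − 2·H₀(q(0)) + I(t)/(r*)², where I(t) = (1/2)·Σ_i |q_i(t)|² and H₀(q) = (1/2)·Σ_{i≠j} ln|q_i − q_j| + (1/(4(r*)²))·Σ_i q_{i,r}². -/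
open Finset

/-- Counterclockwise rotation by `π/2`: for `a = (a_z, a_r)`, `a^⊥ = (−a_r, a_z)`.
Points of `ℝ²` are written with coordinate `0` the `z`-coordinate and
coordinate `1` the `r`-coordinate. -/
noncomputable def perp (a : EuclideanSpace ℝ (Fin 2)) : EuclideanSpace ℝ (Fin 2) :=
  (WithLp.equiv 2 (Fin 2 → ℝ)).symm ![-(a 1), a 0]

/-- The unit vector `e_z = (1, 0)`. -/
noncomputable def ez : EuclideanSpace ℝ (Fin 2) :=
  (WithLp.equiv 2 (Fin 2 → ℝ)).symm ![1, 0]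

/-- The right-hand side of the limiting leapfrogging point system. -/
noncomputable def lfRHS (N : ℕ) (γ rstar : ℝ)
    (q : Fin N → EuclideanSpace ℝ (Fin 2)) (i : Fin N) : EuclideanSpace ℝ (Fin 2) :=
  (γ/(2*Real.pi)) • (∑ j ∈ univ.erase i, (‖q i - q j‖^2)⁻¹ • perp (q i - q j))
    - (γ/(4*Real.pi*rstar^2) * q i 1) • ez

/-- The Hamiltonian of the limiting leapfrogging point system (ordered pairs). -/
noncomputable def H0 (N : ℕ) (rstar : ℝ)
    (q : Fin N → EuclideanSpace ℝ (Fin 2)) : ℝ :=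
  (1/2) * (∑ i, ∑ j ∈ univ.erase i, Real.log ‖q i - q j‖)
    + (1/(4*rstar^2)) * ∑ i, (q i 1)^2

/-- The angular momentum `I(q) = (1/2)·Σ_i |q_i|²`. -/
noncomputable def Imom (N : ℕ) (q : Fin N → EuclideanSpace ℝ (Fin 2)) : ℝ :=
  (1/2) * ∑ i, ‖q i‖^2

open scoped RealInnerProductSpace

/-- Planar vectors are orthogonal to their rotation by a right angle. -/
lemma inner_perp_self (a : EuclideanSpace ℝ (Fin 2)) : ⟪a, perp a⟫ = 0 := by
  simp [perp, PiLp.inner_apply, Fin.sum_univ_two]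
  ring

/-- The logarithmic interaction kernel `a / |a|²`. -/
noncomputable def logKernel (a : EuclideanSpace ℝ (Fin 2)) : EuclideanSpace ℝ (Fin 2) :=
  (‖a‖ ^ 2)⁻¹ • a

lemma logKernel_neg (a : EuclideanSpace ℝ (Fin 2)) : logKernel (-a) = -logKernel a := by
  simp [logKernel]

/-- The gradient of `H0` with respect to the position of the `i`-th point. -/
noncomputable def gradH0 (N : ℕ) (rstar : ℝ)
    (q : Fin N → EuclideanSpace ℝ (Fin 2)) (i : Fin N) : EuclideanSpace ℝ (Fin 2) :=
  ∑ j, logKernel (q i - q j) + (1 / (2 * rstar ^ 2) * q i 1) • EuclideanSpace.single 1 1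

lemma sum_erase_log_eq (N : ℕ) (q : Fin N → EuclideanSpace ℝ (Fin 2)) (i : Fin N) :
    ∑ j ∈ univ.erase i, Real.log ‖q i - q j‖ = ∑ j, Real.log ‖q i - q j‖ :=
  sum_erase _ (by simp)

/-- The system is Hamiltonian: the velocity is the rotated gradient. -/
lemma lfRHS_eq_perp_gradH0 (N : ℕ) (γ rstar : ℝ)
    (q : Fin N → EuclideanSpace ℝ (Fin 2)) (i : Fin N) :
    lfRHS N γ rstar q i = (γ / (2 * Real.pi)) • perp (gradH0 N rstar q i) := by
  have h : ∑ j ∈ univ.erase i, (‖q i - q j‖ ^ 2)⁻¹ • perp (q i - q j)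
      = ∑ j, (‖q i - q j‖ ^ 2)⁻¹ • perp (q i - q j) := sum_erase _ (by simp)
  rw [lfRHS, h]
  ext k
  fin_cases k
  · simp [gradH0, logKernel, perp, ez, mul_sub, sum_sub_distrib]
    ring
  · simp [gradH0, logKernel, perp, ez]

lemma hasDerivWithinAt_log_norm {f : ℝ → EuclideanSpace ℝ (Fin 2)}
    {f' : EuclideanSpace ℝ (Fin 2)} {s : Set ℝ} {t : ℝ}
    (hf : HasDerivWithinAt f f' s t) (h0 : f t ≠ 0) :
    HasDerivWithinAt (fun u => Real.log ‖f u‖) ⟪logKernel (f t), f'⟫ s t := by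
  have hn : ‖f t‖ ^ 2 ≠ 0 := by simpa using h0
  have h := ((hf.norm_sq).log hn).const_mul (1 / 2 : ℝ)
  have hlog : ∀ u, Real.log ‖f u‖ = 1 / 2 * Real.log (‖f u‖ ^ 2) := fun u => by simp
  refine (h.congr (fun u _ => hlog u) (hlog t)).congr_deriv ?_
  rw [logKernel, real_inner_smul_left]
  field_simp

/-- Symmetrization of a double sum against an antisymmetric kernel. -/
lemma half_sum_inner_sub_eq {N : ℕ} {k : Fin N → Fin N → EuclideanSpace ℝ (Fin 2)}
    (hk : ∀ i j, k j i = -k i j) (v : Fin N → EuclideanSpace ℝ (Fin 2)) :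
    (1 / 2 : ℝ) * ∑ i, ∑ j, ⟪k i j, v i - v j⟫ = ∑ i, ⟪∑ j, k i j, v i⟫ := by
  have h : ∑ i, ∑ j, ⟪k i j, v j⟫ = -∑ i, ∑ j, ⟪k i j, v i⟫ := by
    rw [sum_comm, ← sum_neg_distrib]
    refine sum_congr rfl fun i _ => ?_
    rw [← sum_neg_distrib]
    exact sum_congr rfl fun j _ => by rw [hk i j, inner_neg_left]
  simp only [inner_sub_right, sum_sub_distrib, h, sum_inner]
  ring

/-- The chain rule for `H0` along a collisionless curve. -/
lemma hasDerivWithinAt_H0 {N : ℕ} {rstar : ℝ} {q : ℝ → Fin N → EuclideanSpace ℝ (Fin 2)}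
    {v : Fin N → EuclideanSpace ℝ (Fin 2)} {s : Set ℝ} {t : ℝ}
    (hsep : ∀ i j, i ≠ j → q t i ≠ q t j)
    (hq : ∀ i, HasDerivWithinAt (fun u => q u i) (v i) s t) :
    HasDerivWithinAt (fun u => H0 N rstar (q u)) (∑ i, ⟪gradH0 N rstar (q t) i, v i⟫) s t := by
  have hlog : ∀ i j, HasDerivWithinAt (fun u => Real.log ‖q u i - q u j‖)
      ⟪logKernel (q t i - q t j), v i - v j⟫ s t := by
    intro i j
    rcases eq_or_ne i j with rfl | hij
    · simpa using hasDerivWithinAt_const t s (0 : ℝ)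
    · exact hasDerivWithinAt_log_norm ((hq i).sub (hq j)) (sub_ne_zero.2 (hsep i j hij))
  have hcoord : ∀ i, HasDerivWithinAt (fun u => (q u i 1) ^ 2) (2 * q t i 1 * v i 1) s t := by
    intro i
    have h := ((EuclideanSpace.proj (𝕜 := ℝ) (1 : Fin 2)).hasFDerivAt
      (x := q t i)).comp_hasDerivWithinAt t (hq i)
    refine (h.fun_pow 2).congr_deriv ?_
    simp
  have h := ((HasDerivWithinAt.fun_sum fun i (_ : i ∈ univ) =>
    HasDerivWithinAt.fun_sum fun j (_ : j ∈ univ) => hlog i j).const_mul (1 / 2 : ℝ)).fun_add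
    ((HasDerivWithinAt.fun_sum fun i (_ : i ∈ univ) => hcoord i).const_mul (1 / (4 * rstar ^ 2)))
  have hH : ∀ u, H0 N rstar (q u) = 1 / 2 * ∑ i, ∑ j, Real.log ‖q u i - q u j‖
      + 1 / (4 * rstar ^ 2) * ∑ i, (q u i 1) ^ 2 := fun u => by simp only [H0, sum_erase_log_eq]
  refine (h.congr (fun u _ => hH u) (hH t)).congr_deriv ?_
  rw [half_sum_inner_sub_eq (k := fun i j => logKernel (q t i - q t j))
    (fun i j => by rw [← logKernel_neg, neg_sub]), mul_sum, ← sum_add_distrib]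
  refine sum_congr rfl fun i _ => ?_
  rw [gradH0, inner_add_left, real_inner_smul_left, EuclideanSpace.inner_single_left]
  simp
  ring

/-- Conservation of the Hamiltonian. -/
lemma H0_conserved {N : ℕ} {γ rstar T : ℝ} {q : ℝ → Fin N → EuclideanSpace ℝ (Fin 2)}
    (hsep : ∀ t ∈ Set.Icc (0 : ℝ) T, ∀ i j, i ≠ j → q t i ≠ q t j)
    (hode : ∀ i, ∀ t ∈ Set.Icc (0 : ℝ) T,
      HasDerivWithinAt (fun s => q s i) (lfRHS N γ rstar (q t) i) (Set.Icc 0 T) t)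
    {t : ℝ} (ht : t ∈ Set.Icc (0 : ℝ) T) : H0 N rstar (q t) = H0 N rstar (q 0) := by
  have hd : ∀ s ∈ Set.Icc (0 : ℝ) T,
      HasDerivWithinAt (fun u => H0 N rstar (q u)) 0 (Set.Icc 0 T) s := by
    intro s hs
    have h := hasDerivWithinAt_H0 (rstar := rstar) (hsep s hs) (fun i => hode i s hs)
    convert h using 1
    simp [lfRHS_eq_perp_gradH0, real_inner_smul_right, inner_perp_self]
  refine constant_of_derivWithin_zero (fun s hs => (hd s hs).differentiableWithinAt)
    (fun s hs => ?_) t ht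
  exact (hd s (Set.Ico_subset_Icc_self hs)).derivWithin
    (uniqueDiffOn_Icc (hs.1.trans_lt hs.2) s (Set.Ico_subset_Icc_self hs))

lemma sum_coord_sq_le {N : ℕ} (q : Fin N → EuclideanSpace ℝ (Fin 2)) :
    ∑ i, (q i 1) ^ 2 ≤ 2 * Imom N q := by
  have h : ∑ i, (q i 1) ^ 2 ≤ ∑ i, ‖q i‖ ^ 2 := by
    refine sum_le_sum fun i _ => ?_
    rw [EuclideanSpace.real_norm_sq_eq, Fin.sum_univ_two]
    nlinarith [sq_nonneg (q i 0)]
  rw [Imom]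
  linarith

lemma sum_norm_sub_le {N : ℕ} (q : Fin N → EuclideanSpace ℝ (Fin 2)) :
    ∑ i, ∑ j, ‖q i - q j‖ ≤ 2 * Real.sqrt 2 * (N : ℝ) ^ ((3 : ℝ) / 2) * Real.sqrt (Imom N q) := by
  have h1 : ∑ i, ∑ j, ‖q i - q j‖ ≤ 2 * N * ∑ i, ‖q i‖ := by
    calc ∑ i, ∑ j, ‖q i - q j‖ ≤ ∑ i, ∑ j, (‖q i‖ + ‖q j‖) :=
          sum_le_sum fun i _ => sum_le_sum fun j _ => norm_sub_le _ _
      _ = 2 * N * ∑ i, ‖q i‖ := by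
          simp only [sum_add_distrib, sum_const, card_univ, Fintype.card_fin, nsmul_eq_mul,
            ← mul_sum]
          ring
  have h2 : ∑ i, ‖q i‖ ≤ Real.sqrt N * (Real.sqrt 2 * Real.sqrt (Imom N q)) := by
    rw [← Real.sqrt_mul (by norm_num), ← Real.sqrt_mul (Nat.cast_nonneg N)]
    refine Real.le_sqrt_of_sq_le ((sq_sum_le_card_mul_sum_sq).trans_eq ?_)
    simp [Imom]
  have h3 : (N : ℝ) ^ ((3 : ℝ) / 2) = N * Real.sqrt N := by
    rw [Real.sqrt_eq_rpow, show (3 : ℝ) / 2 = 1 + 1 / 2 by norm_num,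
      Real.rpow_add_of_nonneg (Nat.cast_nonneg N) (by norm_num) (by norm_num), Real.rpow_one]
  rw [h3]
  calc _ ≤ 2 * N * ∑ i, ‖q i‖ := h1
    _ ≤ 2 * N * (Real.sqrt N * (Real.sqrt 2 * Real.sqrt (Imom N q))) := by gcongr
    _ = _ := by ring

/-- Logarithms at distance less than one are controlled by the full logarithmic sum. -/
lemma sum_abs_log_filter_le {N : ℕ} (q : Fin N → EuclideanSpace ℝ (Fin 2)) :
    ∑ i, ∑ j ∈ (univ.erase i).filter (fun j => ‖q i - q j‖ < 1), |Real.log ‖q i - q j‖|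
      ≤ ∑ i, ∑ j, ‖q i - q j‖ - ∑ i, ∑ j ∈ univ.erase i, Real.log ‖q i - q j‖ := by
  rw [← sum_sub_distrib]
  refine sum_le_sum fun i _ => ?_
  rw [sum_erase_log_eq, ← sum_sub_distrib, sum_filter]
  refine (sum_le_sum fun j _ => ?_).trans
    (sum_le_sum_of_subset_of_nonneg (erase_subset i univ) fun j _ _ => ?_)
  · split_ifs with h
    · rw [abs_of_nonpos (Real.log_nonpos (norm_nonneg _) h.le)]
      linarith [norm_nonneg (q i - q j)]
    · exact sub_nonneg.2 (Real.log_le_self (norm_nonneg _))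
  · exact sub_nonneg.2 (Real.log_le_self (norm_nonneg _))

/-- Along any `C¹` collisionless solution of the limiting leapfrogging point system on
`[0, T]`, the sum over ordered pairs `(i, j)`, `i ≠ j`, with `|q_i(t) − q_j(t)| < 1`
of `|ln|q_i(t) − q_j(t)||` is at most
`2√2·N^{3/2}·√(I(t)) − 2·H₀(q(0)) + I(t)/(r*)²`. -/
theorem stmt_12 (N : ℕ) (hN : 2 ≤ N) (γ rstar T : ℝ) (hγ : 0 < γ) (hr : 0 < rstar)
    (hT : 0 < T)
    (q : ℝ → Fin N → EuclideanSpace ℝ (Fin 2))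
    (hsep : ∀ t ∈ Set.Icc (0:ℝ) T, ∀ i j, i ≠ j → q t i ≠ q t j)
    (hode : ∀ i, ∀ t ∈ Set.Icc (0:ℝ) T,
      HasDerivWithinAt (fun s => q s i) (lfRHS N γ rstar (q t) i) (Set.Icc 0 T) t) :
    ∀ t ∈ Set.Icc (0:ℝ) T,
      (∑ i, ∑ j ∈ (univ.erase i).filter (fun j => ‖q t i - q t j‖ < 1),
          |Real.log ‖q t i - q t j‖|) ≤
        2 * Real.sqrt 2 * (N:ℝ) ^ ((3:ℝ)/2) * Real.sqrt (Imom N (q t))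
          - 2 * H0 N rstar (q 0) + Imom N (q t) / rstar^2 := by
  intro t ht
  have hH : 2 * H0 N rstar (q 0) = ∑ i, ∑ j ∈ univ.erase i, Real.log ‖q t i - q t j‖
      + 1 / (2 * rstar ^ 2) * ∑ i, (q t i 1) ^ 2 := by
    rw [← H0_conserved hsep hode ht, H0]
    ring
  have hI : 1 / (2 * rstar ^ 2) * ∑ i, (q t i 1) ^ 2 ≤ Imom N (q t) / rstar ^ 2 :=
    calc _ ≤ 1 / (2 * rstar ^ 2) * (2 * Imom N (q t)) := by
          gcongr
          exact sum_coord_sq_le (q t)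
      _ = _ := by field_simp
  linarith [sum_abs_log_filter_le (q t), sum_norm_sub_le (q t)]
end
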